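/- Let n ≥ 2 and k ∈ ℝ, and let M = (a, b; c, d) ∈ SAV(ℝ⊕ℝ^{n−1}). If u : H⁺ → ℝ is a smooth solution of the k-hyperbolic harmonic equation x_n Δu − k ∂u/∂x_n = 0 on H⁺, then F(x) := ‖cx+d‖^{−(n−k−1)} u(M<x>) is also a solution of x_n ΔF − k ∂F/∂x_n = 0 on H⁺. -/

import Mathlib

noncomputable section

open scoped symmDiff

/-- An explicit model of the real Clifford algebra `Cl_n` with generators `e 0, …, e (n-1)`
satisfying `eᵢ eⱼ + eⱼ eᵢ = -2 δᵢⱼ` (the Clifford algebra of the negative definite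
quadratic form on `ℝⁿ`): elements are coordinate functions on the canonical basis
`(e_A)_{A ⊆ {0,…,n-1}}`, where `e_A` is the (increasingly ordered) product of the `e i`, `i ∈ A`. -/
def Cl (n : ℕ) : Type := Finset (Fin n) → ℝ

namespace Cl

variable {n : ℕ}

instance : NormedAddCommGroup (Cl n) :=
  inferInstanceAs (NormedAddCommGroup (Finset (Fin n) → ℝ))

instance : NormedSpace ℝ (Cl n) :=
  inferInstanceAs (NormedSpace ℝ (Finset (Fin n) → ℝ))

/-- The coefficient of `a` at the basis element `e_A`. -/
def coeff (a : Cl n) (A : Finset (Fin n)) : ℝ := a A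

/-- The sign occurring in the product `e_A * e_B = mulSign A B • e_{A ∆ B}`,
coming from the relations `eᵢ eⱼ = -eⱼ eᵢ` (i ≠ j) and `eᵢ² = -1`. -/
def mulSign (A B : Finset (Fin n)) : ℝ :=
  (-1 : ℝ) ^ (((A ×ˢ B).filter fun p => p.2 < p.1).card + (A ∩ B).card)

/-- Clifford multiplication. -/
def mul (a b : Cl n) : Cl n := fun C =>
  ∑ A : Finset (Fin n), ∑ B : Finset (Fin n),
    if A ∆ B = C then mulSign A B * a A * b B else 0

/-- The unit `1` of the Clifford algebra. -/
def one : Cl n := Pi.single ∅ 1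

/-- The embedding of the real scalars. -/
def scalar (r : ℝ) : Cl n := Pi.single ∅ r

/-- The generators `e i` (in the paper: `e_1, …, e_n`). -/
def e (i : Fin n) : Cl n := Pi.single {i} 1

/-- Reversion: the anti-automorphism fixing all the `e i`. -/
def reverse (a : Cl n) : Cl n := fun A => (-1 : ℝ) ^ (A.card * (A.card - 1) / 2) * a A

/-- The main involution `′`: the automorphism with `(e i)′ = - e i`. -/
def involute (a : Cl n) : Cl n := fun A => (-1 : ℝ) ^ A.card * a A

/-- Clifford conjugation: the anti-automorphism with `conj (e i) = - e i`
(the composite of reversion and the main involution). -/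
def conj (a : Cl n) : Cl n := fun A => (-1 : ℝ) ^ (A.card * (A.card + 1) / 2) * a A

/-- The norm on `Cl n`: the square root of the sum of the squares of the
coordinates in the standard basis. -/
def norm (a : Cl n) : ℝ := Real.sqrt (∑ A : Finset (Fin n), a A ^ 2)

/-- Invertibility in the Clifford algebra. -/
def IsInvertible (a : Cl n) : Prop := ∃ b, mul a b = one ∧ mul b a = one

/-- The inverse of an invertible Clifford number (junk value `0` otherwise). -/
def inv (a : Cl n) : Cl n :=
  letI := Classical.propDecidable (IsInvertible a)
  if h : IsInvertible a then h.choose else 0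

/-- The paravector `x₀ + x₁ e₁ + ⋯ + xₙ eₙ` attached to `x ∈ ℝ^{n+1}`. -/
def para (x : Fin (n + 1) → ℝ) : Cl n :=
  scalar (x 0) + ∑ i : Fin n, x i.succ • e i

/-- Being a paravector. -/
def IsParavector (a : Cl n) : Prop := ∃ x : Fin (n + 1) → ℝ, a = para x

/-- The coordinates in `ℝ^{n+1}` of (the paravector part of) a Clifford number. -/
def paraCoord (a : Cl n) : Fin (n + 1) → ℝ :=
  Fin.cases (coeff a ∅) (fun i => coeff a {i})

/-- Being a (possibly empty) product of nonzero paravectors. -/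
def IsProdOfParavectors (a : Cl n) : Prop :=
  ∃ l : List (Fin (n + 1) → ℝ), (∀ x ∈ l, x ≠ 0) ∧
    a = l.foldr (fun x b => mul (para x) b) one

/-- The special Ahlfors–Vahlen group `SAV(ℝ ⊕ ℝⁿ)`: 2×2 matrices `(a b; c d)` with entries
in `Cl n` such that each entry is `0` or a product of nonzero paravectors,
`a ⬝ reverse d - b ⬝ reverse c = 1`, and `a c⁻¹, c⁻¹ d` are paravectors if `c ≠ 0`
resp. `b d⁻¹` is a paravector if `c = 0`. -/
structure SAV (n : ℕ) where
  a : Cl n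
  b : Cl n
  c : Cl n
  d : Cl n
  prod_a : a = 0 ∨ IsProdOfParavectors a
  prod_b : b = 0 ∨ IsProdOfParavectors b
  prod_c : c = 0 ∨ IsProdOfParavectors c
  prod_d : d = 0 ∨ IsProdOfParavectors d
  det : mul a (reverse d) - mul b (reverse c) = one
  cond_c : c ≠ 0 → IsParavector (mul a (inv c)) ∧ IsParavector (mul (inv c) d)
  cond_c0 : c = 0 → IsParavector (mul b (inv d))

/-- The Clifford number `c x + d` attached to a matrix `M` and `x ∈ ℝ^{n+1}`. -/
def cxd (M : SAV n) (x : Fin (n + 1) → ℝ) : Cl n := mul M.c (para x) + M.d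

/-- The numerator `a x + b`. -/
def axb (M : SAV n) (x : Fin (n + 1) → ℝ) : Cl n := mul M.a (para x) + M.b

/-- The Möbius transformation `M<x> = (ax+b)(cx+d)⁻¹` as a Clifford number. -/
def moebiusCl (M : SAV n) (x : Fin (n + 1) → ℝ) : Cl n := mul (axb M x) (inv (cxd M x))

/-- The Möbius transformation `M<x>` as a point of `ℝ^{n+1}`. -/
def moebius (M : SAV n) (x : Fin (n + 1) → ℝ) : Fin (n + 1) → ℝ :=
  paraCoord (moebiusCl M x)

/-- `a` lies in the subalgebra `Cl_{n-1}` generated by the `e j` with `j ≠ i`. -/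
def memSub (a : Cl n) (i : Fin n) : Prop := ∀ A : Finset (Fin n), i ∈ A → coeff a A = 0

/-- The subgroup `SAV(ℝ ⊕ ℝ^{m})` of `SAV(ℝ ⊕ ℝ^{m+1})` of matrices whose entries lie
in the subalgebra `Cl_m ⊆ Cl_{m+1}`. -/
structure SAVsub (m : ℕ) extends SAV (m + 1) where
  sub_a : memSub a (Fin.last m)
  sub_b : memSub b (Fin.last m)
  sub_c : memSub c (Fin.last m)
  sub_d : memSub d (Fin.last m)

/-- The `P`-part of `a ∈ Cl_{m+1} = Cl_m ⊕ Cl_m e_{top}`: `a = P a + (Q a) e_top`. -/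
def Ppart {m : ℕ} (a : Cl (m + 1)) : Cl (m + 1) := fun A =>
  if Fin.last m ∈ A then 0 else a A

/-- The `Q`-part of `a ∈ Cl_{m+1} = Cl_m ⊕ Cl_m e_{top}`: `a = P a + (Q a) e_top`. -/
def Qpart {m : ℕ} (a : Cl (m + 1)) : Cl (m + 1) := fun A =>
  if Fin.last m ∈ A then 0 else a (insert (Fin.last m) A)

/-- Partial derivative `∂f/∂xᵢ`. -/
def pderiv {E : Type*} [NormedAddCommGroup E] [NormedSpace ℝ E] {m : ℕ}
    (i : Fin m) (f : (Fin m → ℝ) → E) (x : Fin m → ℝ) : E :=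
  fderiv ℝ f x (Pi.single i 1)

/-- The Euclidean Laplacian `Δ = Σᵢ ∂²/∂xᵢ²` (acting componentwise). -/
def lap {E : Type*} [NormedAddCommGroup E] [NormedSpace ℝ E] {m : ℕ}
    (f : (Fin m → ℝ) → E) : (Fin m → ℝ) → E :=
  fun x => ∑ i : Fin m, pderiv i (pderiv i f) x

/-- The Euclidean Dirac operator `D f = ∂f/∂x₀ + Σᵢ eᵢ ∂f/∂xᵢ`. -/
def dirac (f : (Fin (n + 1) → ℝ) → Cl n) : (Fin (n + 1) → ℝ) → Cl n :=
  fun x => pderiv 0 f x + ∑ i : Fin n, mul (e i) (pderiv i.succ f x)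

/-- Upper half-space `H⁺ = {x ∈ ℝ^{n+1} : xₙ > 0}`. -/
def upperHalf (n : ℕ) : Set (Fin (n + 1) → ℝ) := {x | 0 < x (Fin.last n)}

/-- The Euclidean norm on `ℝ^m`. -/
def enorm {m : ℕ} (x : Fin m → ℝ) : ℝ := Real.sqrt (∑ i, x i ^ 2)

end Cl
namespace Cl

section Algebra

variable {n : ℕ}

/-- The sign bicharacter in product form. -/
lemma mulSign_eq_prod (A B : Finset (Fin n)) :
    mulSign A B = ∏ i ∈ A, ∏ j ∈ B, if j ≤ i then (-1 : ℝ) else 1 := by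
  rw [← Finset.prod_product', Finset.prod_ite, Finset.prod_const, Finset.prod_const_one, mul_one,
    mulSign]
  congr 1
  have h : (A ∩ B).card = ((A ×ˢ B).filter fun p => p.2 = p.1).card := by
    refine Finset.card_bij (fun i _ => (i, i)) ?_ ?_ ?_
    · intro i hi
      simpa using hi
    · intro i _ j _ hij
      simpa using hij
    · rintro ⟨i, j⟩ hij
      simp only [Finset.mem_filter, Finset.mem_product] at hij
      obtain ⟨⟨h1, h2⟩, rfl⟩ := hij
      exact ⟨j, by simp [h1, h2], rfl⟩
  rw [h, ← Finset.card_union_of_disjoint, ← Finset.filter_or]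
  · simp only [le_iff_lt_or_eq]
  · rw [Finset.disjoint_filter]
    intro p _ h1 h2
    exact h1.ne h2

lemma prod_symmDiff_of_sq_eq_one {ι : Type*} [DecidableEq ι] (A B : Finset ι) (f : ι → ℝ)
    (hf : ∀ i, f i * f i = 1) : ∏ i ∈ A ∆ B, f i = (∏ i ∈ A, f i) * ∏ i ∈ B, f i := by
  have h1 : ∏ i ∈ A ∆ B, f i = (∏ i ∈ A \ B, f i) * ∏ i ∈ B \ A, f i := by
    rw [symmDiff_def, Finset.sup_eq_union, Finset.prod_union disjoint_sdiff_sdiff]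
  have h2 : (∏ i ∈ A ∩ B, f i) * ∏ i ∈ A ∩ B, f i = 1 := by
    rw [← Finset.prod_mul_distrib]
    exact Finset.prod_eq_one fun i _ => hf i
  rw [h1, ← Finset.prod_inter_mul_prod_sdiff A B f, ← Finset.prod_inter_mul_prod_sdiff B A f,
    Finset.inter_comm B A]
  linear_combination (-(∏ i ∈ A \ B, f i) * ∏ i ∈ B \ A, f i) * h2

lemma mulSign_symmDiff_left (A B C : Finset (Fin n)) :
    mulSign (A ∆ B) C = mulSign A C * mulSign B C := by
  simp only [mulSign_eq_prod]
  refine prod_symmDiff_of_sq_eq_one _ _ _ fun i => ?_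
  rw [← Finset.prod_mul_distrib]
  exact Finset.prod_eq_one fun j _ => by split_ifs <;> norm_num

lemma mulSign_symmDiff_right (A B C : Finset (Fin n)) :
    mulSign A (B ∆ C) = mulSign A B * mulSign A C := by
  simp only [mulSign_eq_prod, ← Finset.prod_mul_distrib]
  refine Finset.prod_congr rfl fun i _ => ?_
  exact prod_symmDiff_of_sq_eq_one _ _ _ fun j => by split_ifs <;> norm_num

lemma mulSign_mul_self (A B : Finset (Fin n)) : mulSign A B * mulSign A B = 1 := by
  rw [mulSign, ← pow_add, ← two_mul, pow_mul]
  norm_num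

lemma mulSign_empty_left (A : Finset (Fin n)) : mulSign ∅ A = 1 := by
  simp [mulSign_eq_prod]

lemma mulSign_empty_right (A : Finset (Fin n)) : mulSign A ∅ = 1 := by
  simp [mulSign_eq_prod]

lemma mulSign_diag (A : Finset (Fin n)) :
    mulSign A A = (-1 : ℝ) ^ (A.card * (A.card + 1) / 2) := by
  rw [mulSign_eq_prod]
  induction A using Finset.induction_on_max with
  | empty => simp
  | insert a s hs ih =>
    have ha : a ∉ s := fun h => (hs a h).false
    have h1 : ∀ i ∈ s, (∏ j ∈ insert a s, if j ≤ i then (-1 : ℝ) else 1) =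
        ∏ j ∈ s, if j ≤ i then (-1 : ℝ) else 1 := by
      intro i hi
      rw [Finset.prod_insert ha, if_neg (not_le.mpr (hs i hi)), one_mul]
    have h2 : (∏ j ∈ insert a s, if j ≤ a then (-1 : ℝ) else 1) = (-1) ^ (s.card + 1) := by
      rw [← Finset.card_insert_of_notMem ha]
      refine Finset.prod_eq_pow_card fun j hj => if_pos ?_
      rcases Finset.mem_insert.mp hj with rfl | hj
      · exact le_rfl
      · exact (hs j hj).le
    rw [Finset.prod_insert ha, Finset.prod_congr rfl h1, h2, ih, ← pow_add,
      Finset.card_insert_of_notMem ha]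
    congr 1
    have : (s.card + 1) * (s.card + 1 + 1) = s.card * (s.card + 1) + 2 * (s.card + 1) := by ring
    rw [this, Nat.add_mul_div_left _ _ (by norm_num), add_comm]

lemma ext_coeff {a b : Cl n} (h : ∀ A, coeff a A = coeff b A) : a = b := funext h

/-- Symmetric difference with a fixed set, as a permutation. -/
def symmDiffPerm (A : Finset (Fin n)) : Equiv.Perm (Finset (Fin n)) where
  toFun E := A ∆ E
  invFun E := A ∆ E
  left_inv := symmDiff_symmDiff_cancel_left A
  right_inv := symmDiff_symmDiff_cancel_left A

lemma symmDiffPerm_apply (A E : Finset (Fin n)) : symmDiffPerm A E = A ∆ E := rfl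

@[simp] lemma coeff_add (a b : Cl n) (A : Finset (Fin n)) :
    coeff (a + b) A = coeff a A + coeff b A := rfl

@[simp] lemma coeff_smul (r : ℝ) (a : Cl n) (A : Finset (Fin n)) :
    coeff (r • a) A = r * coeff a A := rfl

@[simp] lemma coeff_zero (A : Finset (Fin n)) : coeff (0 : Cl n) A = 0 := rfl

lemma coeff_mul (a b : Cl n) (C : Finset (Fin n)) :
    coeff (mul a b) C = ∑ A, mulSign A (A ∆ C) * coeff a A * coeff b (A ∆ C) := by
  change ∑ A, ∑ B, (if A ∆ B = C then mulSign A B * a A * b B else 0) = _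
  refine Finset.sum_congr rfl fun A _ => ?_
  rw [Finset.sum_eq_single (A ∆ C)]
  · rw [if_pos (symmDiff_symmDiff_cancel_left A C)]
    rfl
  · intro B _ hB
    refine if_neg fun h => hB ?_
    rw [← h, symmDiff_symmDiff_cancel_left]
  · simp

lemma coeff_conj (a : Cl n) (A : Finset (Fin n)) :
    coeff (conj a) A = mulSign A A * coeff a A := by
  rw [mulSign_diag]
  rfl

lemma coeff_involute (a : Cl n) (A : Finset (Fin n)) :
    coeff (involute a) A = (∏ _i ∈ A, (-1 : ℝ)) * coeff a A := by
  rw [Finset.prod_const]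
  rfl

lemma coeff_scalar (r : ℝ) (A : Finset (Fin n)) :
    coeff (scalar r : Cl n) A = if A = ∅ then r else 0 := by
  simp [coeff, scalar, Pi.single_apply]

lemma coeff_e (i : Fin n) (A : Finset (Fin n)) :
    coeff (e i) A = if A = {i} then 1 else 0 := by
  simp [coeff, e, Pi.single_apply]

/-- The basis element `e_A`. -/
def blade (A : Finset (Fin n)) : Cl n := Pi.single A 1

lemma coeff_blade (A B : Finset (Fin n)) :
    coeff (blade A) B = if B = A then 1 else 0 := by
  simp [coeff, blade, Pi.single_apply]

lemma coeff_one (A : Finset (Fin n)) : coeff (one : Cl n) A = if A = ∅ then 1 else 0 :=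
  coeff_scalar 1 A

lemma mul_assoc' (a b c : Cl n) : mul (mul a b) c = mul a (mul b c) := by
  refine ext_coeff fun D => ?_
  simp only [coeff_mul, Finset.mul_sum, Finset.sum_mul]
  rw [Finset.sum_comm]
  refine Finset.sum_congr rfl fun A _ => ?_
  refine Fintype.sum_equiv (symmDiffPerm A) _ _ fun E => ?_
  have h1 : (A ∆ E) ∆ (A ∆ D) = E ∆ D := by
    rw [symmDiff_symmDiff_symmDiff_comm, symmDiff_self, bot_symmDiff]
  simp only [symmDiffPerm_apply, h1]
  have h2 : mulSign E (E ∆ D) = mulSign A (E ∆ D) * mulSign (A ∆ E) (E ∆ D) := by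
    rw [← mulSign_symmDiff_left, symmDiff_symmDiff_cancel_left]
  have h3 : mulSign A (A ∆ D) = mulSign A (A ∆ E) * mulSign A (E ∆ D) := by
    rw [← mulSign_symmDiff_right]
    congr 1
    rw [symmDiff_assoc, symmDiff_symmDiff_cancel_left]
  rw [h2, h3]
  ring

lemma one_mul' (a : Cl n) : mul one a = a := by
  refine ext_coeff fun D => ?_
  rw [coeff_mul, Finset.sum_eq_single ∅]
  · rw [mulSign_empty_left, coeff_one, if_pos rfl, ← Finset.bot_eq_empty, bot_symmDiff]
    ring
  · intro A _ hA
    rw [coeff_one, if_neg hA]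
    ring
  · simp

lemma mul_one' (a : Cl n) : mul a one = a := by
  refine ext_coeff fun D => ?_
  rw [coeff_mul, Finset.sum_eq_single D]
  · rw [symmDiff_self, Finset.bot_eq_empty, mulSign_empty_right, coeff_one, if_pos rfl]
    ring
  · intro A _ hA
    have h : A ∆ D ≠ ∅ := fun h => hA (symmDiff_eq_bot.mp h)
    rw [coeff_one, if_neg h]
    ring
  · simp

lemma mul_add' (a b c : Cl n) : mul a (b + c) = mul a b + mul a c := by
  refine ext_coeff fun D => ?_
  simp only [coeff_mul, coeff_add, mul_add, Finset.sum_add_distrib]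

lemma add_mul' (a b c : Cl n) : mul (a + b) c = mul a c + mul b c := by
  refine ext_coeff fun D => ?_
  simp only [coeff_mul, coeff_add, mul_add, add_mul, Finset.sum_add_distrib]

lemma mul_smul' (r : ℝ) (a b : Cl n) : mul a (r • b) = r • mul a b := by
  refine ext_coeff fun D => ?_
  simp only [coeff_mul, coeff_smul, Finset.mul_sum]
  exact Finset.sum_congr rfl fun A _ => by ring

lemma smul_mul' (r : ℝ) (a b : Cl n) : mul (r • a) b = r • mul a b := by
  refine ext_coeff fun D => ?_
  simp only [coeff_mul, coeff_smul, Finset.mul_sum]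
  exact Finset.sum_congr rfl fun A _ => by ring

/-- The ring structure on the model `Cl n` given by Clifford multiplication. -/
instance instRing : Ring (Cl n) :=
  { (inferInstance : AddCommGroup (Cl n)) with
    mul := mul
    one := one
    mul_assoc := mul_assoc'
    one_mul := one_mul'
    mul_one := mul_one'
    left_distrib := mul_add'
    right_distrib := add_mul'
    zero_mul := fun a => by
      have h := smul_mul' 0 (0 : Cl n) a
      rw [zero_smul, zero_smul] at h
      exact h
    mul_zero := fun a => by
      have h := mul_smul' 0 a (0 : Cl n)
      rw [zero_smul, zero_smul] at h
      exact h }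

instance instIsScalarTower : IsScalarTower ℝ (Cl n) (Cl n) := ⟨fun r a b => smul_mul' r a b⟩

instance instSMulCommClass : SMulCommClass ℝ (Cl n) (Cl n) :=
  ⟨fun r a b => (mul_smul' r a b).symm⟩

lemma mul_def (a b : Cl n) : mul a b = a * b := rfl

lemma one_def : (one : Cl n) = 1 := rfl

lemma scalar_eq_smul (r : ℝ) : (scalar r : Cl n) = r • (1 : Cl n) := by
  refine ext_coeff fun A => ?_
  rw [coeff_smul, ← one_def, coeff_one, coeff_scalar]
  split_ifs <;> simp

lemma coeff_sum {ι : Type*} (s : Finset ι) (f : ι → Cl n) (A : Finset (Fin n)) :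
    coeff (∑ i ∈ s, f i) A = ∑ i ∈ s, coeff (f i) A :=
  map_sum (⟨⟨fun a => coeff a A, rfl⟩, fun _ _ => rfl⟩ : Cl n →+ ℝ) f s

lemma conj_mul (a b : Cl n) : conj (a * b) = conj b * conj a := by
  refine ext_coeff fun D => ?_
  rw [coeff_conj, ← mul_def, ← mul_def, coeff_mul, coeff_mul, Finset.mul_sum]
  refine Fintype.sum_equiv (symmDiffPerm D) _ _ fun A => ?_
  simp only [symmDiffPerm_apply, symmDiff_comm D A, symmDiff_symmDiff_cancel_right, coeff_conj]
  have h : mulSign D D = mulSign A A * mulSign A (A ∆ D) *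
      (mulSign (A ∆ D) A * mulSign (A ∆ D) (A ∆ D)) := by
    rw [← mulSign_symmDiff_right, ← mulSign_symmDiff_right, ← mulSign_symmDiff_left,
      symmDiff_symmDiff_cancel_left]
  rw [h]
  linear_combination (mulSign A A * mulSign (A ∆ D) A * mulSign (A ∆ D) (A ∆ D) * coeff a A *
    coeff b (A ∆ D)) * mulSign_mul_self A (A ∆ D)

lemma involute_mul (a b : Cl n) : involute (a * b) = involute a * involute b := by
  refine ext_coeff fun D => ?_
  rw [coeff_involute, ← mul_def, ← mul_def, coeff_mul, coeff_mul, Finset.mul_sum]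
  refine Finset.sum_congr rfl fun A _ => ?_
  have h : (∏ _i ∈ D, (-1 : ℝ)) = (∏ _i ∈ A, (-1 : ℝ)) * ∏ _i ∈ A ∆ D, (-1 : ℝ) := by
    rw [← prod_symmDiff_of_sq_eq_one _ _ _ (fun _ => by norm_num), symmDiff_symmDiff_cancel_left]
  rw [coeff_involute, coeff_involute, h]
  ring

lemma reverse_eq (a : Cl n) : reverse a = conj (involute a) := by
  refine funext fun A => ?_
  have h : A.card * (A.card + 1) / 2 = A.card * (A.card - 1) / 2 + A.card := by
    rw [← Nat.add_mul_div_left _ _ (by norm_num : 0 < 2)]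
    congr 1
    rcases A.card with _ | k
    · simp
    · simp only [Nat.add_sub_cancel]
      ring
  simp only [reverse, conj, involute, h, pow_add]
  have h2 : (-1 : ℝ) ^ A.card * (-1) ^ A.card = 1 := by
    rw [← mul_pow]
    norm_num
  linear_combination (-(-1 : ℝ) ^ (A.card * (A.card - 1) / 2) * a A) * h2

lemma reverse_mul (a b : Cl n) : reverse (a * b) = reverse b * reverse a := by
  rw [reverse_eq, reverse_eq, reverse_eq, involute_mul, conj_mul]

lemma conj_involute (a : Cl n) : conj (involute a) = involute (conj a) := by
  refine ext_coeff fun A => ?_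
  simp only [coeff_conj, coeff_involute]
  ring

lemma conj_conj (a : Cl n) : conj (conj a) = a := by
  refine ext_coeff fun A => ?_
  simp only [coeff_conj]
  rw [← mul_assoc, mulSign_mul_self, one_mul]

lemma involute_smul (r : ℝ) (a : Cl n) : involute (r • a) = r • involute a := by
  refine ext_coeff fun A => ?_
  simp only [coeff_smul, coeff_involute]
  ring

lemma conj_one : conj (1 : Cl n) = 1 := by
  refine ext_coeff fun A => ?_
  rw [coeff_conj, ← one_def, coeff_one]
  split_ifs with h
  · rw [h, mulSign_empty_left, one_mul]
  · rw [mul_zero]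

lemma involute_one : involute (1 : Cl n) = 1 := by
  refine ext_coeff fun A => ?_
  rw [coeff_involute, ← one_def, coeff_one]
  split_ifs with h
  · rw [h, Finset.prod_empty, one_mul]
  · rw [mul_zero]

lemma reverse_zero : reverse (0 : Cl n) = 0 := by
  refine funext fun A => ?_
  exact mul_zero _

lemma one_ne_zero' : (1 : Cl n) ≠ 0 := by
  intro h
  have h2 := congrArg (fun a => coeff a ∅) h
  simp only [← one_def, coeff_one, coeff_zero, if_true] at h2
  exact one_ne_zero h2

lemma coeff_mul_conj_self (a : Cl n) : coeff (a * conj a) ∅ = ∑ A, a A ^ 2 := by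
  rw [← mul_def, coeff_mul]
  refine Finset.sum_congr rfl fun A _ => ?_
  rw [← Finset.bot_eq_empty, symmDiff_bot, coeff_conj]
  change _ = coeff a A ^ 2
  linear_combination (coeff a A ^ 2) * mulSign_mul_self A A

lemma norm_of_mul_conj_self {a : Cl n} {r : ℝ} (h : a * conj a = r • (1 : Cl n)) :
    norm a = Real.sqrt r := by
  rw [norm, ← coeff_mul_conj_self, h, coeff_smul, ← one_def, coeff_one, if_pos rfl, mul_one]

lemma coeff_para (x : Fin (n + 1) → ℝ) (A : Finset (Fin n)) :
    coeff (para x) A = (if A = ∅ then x 0 else 0) + ∑ i, if A = {i} then x i.succ else 0 := by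
  rw [para, coeff_add, coeff_scalar, coeff_sum]
  congr 1
  refine Finset.sum_congr rfl fun i _ => ?_
  rw [coeff_smul, coeff_e]
  split_ifs <;> simp

lemma coeff_para_empty (x : Fin (n + 1) → ℝ) : coeff (para x) ∅ = x 0 := by
  rw [coeff_para, if_pos rfl, Finset.sum_eq_zero, add_zero]
  intro i _
  exact if_neg (Finset.singleton_ne_empty i).symm

lemma coeff_para_singleton (x : Fin (n + 1) → ℝ) (i : Fin n) :
    coeff (para x) {i} = x i.succ := by
  rw [coeff_para, if_neg (Finset.singleton_ne_empty i), zero_add]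
  simp only [Finset.singleton_inj]
  simp

lemma paraCoord_para (x : Fin (n + 1) → ℝ) : paraCoord (para x) = x := by
  funext i
  refine Fin.cases ?_ (fun i => ?_) i
  · exact coeff_para_empty x
  · exact coeff_para_singleton x i

lemma paraCoord_add (a b : Cl n) : paraCoord (a + b) = paraCoord a + paraCoord b := by
  funext i
  refine Fin.cases ?_ (fun i => ?_) i <;> rfl

lemma paraCoord_smul (r : ℝ) (a : Cl n) : paraCoord (r • a) = r • paraCoord a := by
  funext i
  refine Fin.cases ?_ (fun i => ?_) i <;> rfl

lemma para_add (x y : Fin (n + 1) → ℝ) : para (x + y) = para x + para y := by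
  refine ext_coeff fun A => ?_
  simp only [coeff_add, coeff_para, Pi.add_apply]
  rw [add_add_add_comm, ← Finset.sum_add_distrib]
  congr 1
  · split_ifs <;> simp
  · exact Finset.sum_congr rfl fun i _ => by split_ifs <;> simp

lemma para_smul (r : ℝ) (x : Fin (n + 1) → ℝ) : para (r • x) = r • para x := by
  refine ext_coeff fun A => ?_
  simp only [coeff_smul, coeff_para, Pi.smul_apply, smul_eq_mul, mul_add, Finset.mul_sum]
  congr 1
  · split_ifs <;> simp
  · exact Finset.sum_congr rfl fun i _ => by split_ifs <;> simp

lemma para_single_succ (i : Fin n) : para (Pi.single i.succ 1) = e i := by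
  refine ext_coeff fun A => ?_
  rw [coeff_para, coeff_e, Pi.single_eq_of_ne (Fin.succ_ne_zero i).symm,
    Finset.sum_eq_single i]
  · simp
  · intro j _ hj
    rw [Pi.single_eq_of_ne (fun h => hj (Fin.succ_injective _ h))]
    simp
  · simp

/-- Conjugation of paravectors in coordinates. -/
def cbar : (Fin (n + 1) → ℝ) →ₗ[ℝ] (Fin (n + 1) → ℝ) where
  toFun x := Fin.cons (x 0) fun i => -x i.succ
  map_add' x y := by
    funext i
    refine Fin.cases ?_ (fun i => ?_) i <;> simp [add_comm]
  map_smul' r x := by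
    funext i
    refine Fin.cases ?_ (fun i => ?_) i <;> simp

@[simp] lemma cbar_zero (x : Fin (n + 1) → ℝ) : cbar x 0 = x 0 := rfl

@[simp] lemma cbar_succ (x : Fin (n + 1) → ℝ) (i : Fin n) : cbar x i.succ = -x i.succ := rfl

lemma cbar_cbar (x : Fin (n + 1) → ℝ) : cbar (cbar x) = x := by
  funext i
  refine Fin.cases ?_ (fun i => ?_) i <;> simp

lemma sum_sq_cbar (x : Fin (n + 1) → ℝ) : ∑ i, cbar x i ^ 2 = ∑ i, x i ^ 2 := by
  simp [Fin.sum_univ_succ]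

lemma involute_para (x : Fin (n + 1) → ℝ) : involute (para x) = para (cbar x) := by
  refine ext_coeff fun A => ?_
  rw [coeff_involute, coeff_para, coeff_para, mul_add, Finset.mul_sum]
  congr 1
  · split_ifs with h <;> simp [h]
  · refine Finset.sum_congr rfl fun i _ => ?_
    split_ifs with h <;> simp [h]

lemma conj_para (x : Fin (n + 1) → ℝ) : conj (para x) = para (cbar x) := by
  refine ext_coeff fun A => ?_
  rw [coeff_conj, coeff_para, coeff_para, mul_add, Finset.mul_sum]
  congr 1
  · split_ifs with h <;> simp [h, mulSign_diag]
  · refine Finset.sum_congr rfl fun i _ => ?_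
    split_ifs with h <;> simp [h, mulSign_diag]

lemma reverse_para (x : Fin (n + 1) → ℝ) : reverse (para x) = para x := by
  rw [reverse_eq, involute_para, conj_para, cbar_cbar]

lemma e_mul_e (i j : Fin n) :
    e i * e j = mulSign {i} {j} • blade (({i} : Finset (Fin n)) ∆ {j}) := by
  refine ext_coeff fun D => ?_
  rw [← mul_def, coeff_mul, Finset.sum_eq_single {i}]
  · rw [coeff_smul, coeff_e, if_pos rfl, coeff_e, coeff_blade]
    by_cases h : D = ({i} : Finset (Fin n)) ∆ {j}
    · rw [h, symmDiff_symmDiff_cancel_left]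
      simp
    · rw [if_neg h, if_neg]
      · simp
      · intro h2
        apply h
        rw [← h2, symmDiff_symmDiff_cancel_left]
  · intro A _ hA
    rw [coeff_e, if_neg hA]
    ring
  · simp

lemma e_anticomm (i j : Fin n) :
    e i * e j + e j * e i = (if i = j then -2 else 0 : ℝ) • (1 : Cl n) := by
  rw [e_mul_e, e_mul_e, symmDiff_comm ({j} : Finset (Fin n)), ← add_smul]
  by_cases h : i = j
  · subst h
    rw [if_pos rfl, symmDiff_self]
    have : mulSign {i} {i} + mulSign {i} {i} = -2 := by
      rw [mulSign_diag]
      norm_num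
    rw [this]
    rfl
  · rw [if_neg h]
    have : mulSign {i} {j} + mulSign {j} {i} = 0 := by
      simp only [mulSign_eq_prod, Finset.prod_singleton]
      rcases lt_or_gt_of_ne h with h | h
      · rw [if_neg (not_le.mpr h), if_pos h.le]
        norm_num
      · rw [if_pos h.le, if_neg (not_le.mpr h)]
        norm_num
    rw [this, zero_smul, zero_smul]

lemma vector_anticomm (x y : Fin n → ℝ) :
    (∑ i, x i • e i) * (∑ i, y i • e i) + (∑ i, y i • e i) * (∑ i, x i • e i) =
      (-2 * ∑ i, x i * y i) • (1 : Cl n) := by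
  rw [Finset.sum_mul_sum, Finset.sum_mul_sum, Finset.sum_comm (γ := Fin n)]
  simp only [smul_mul_smul_comm]
  rw [← Finset.sum_add_distrib, Finset.mul_sum, Finset.sum_smul]
  refine Finset.sum_congr rfl fun j _ => ?_
  rw [← Finset.sum_add_distrib]
  have : ∀ i, (x i * y j) • (e i * e j) + (y j * x i) • (e j * e i) =
      (if i = j then -2 * (x i * y j) else 0 : ℝ) • (1 : Cl n) := by
    intro i
    rw [mul_comm (y j), ← smul_add, e_anticomm, smul_smul]
    congr 1
    split_ifs <;> ring
  simp only [this]
  rw [← Finset.sum_smul, Finset.sum_ite_eq' Finset.univ j]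
  simp

lemma para_mul_cbar_add (x y : Fin (n + 1) → ℝ) :
    para x * para (cbar y) + para y * para (cbar x) = (2 * ∑ i, x i * y i) • (1 : Cl n) := by
  have h1 : ∀ z : Fin (n + 1) → ℝ, para z = z 0 • (1 : Cl n) + ∑ i : Fin n, z i.succ • e i := by
    intro z
    rw [para, scalar_eq_smul]
  have h2 : ∀ z : Fin (n + 1) → ℝ, para (cbar z) =
      z 0 • (1 : Cl n) - ∑ i : Fin n, z i.succ • e i := by
    intro z
    rw [h1]
    simp [sub_eq_add_neg]
  have h3 := vector_anticomm (fun i => x i.succ) (fun i => y i.succ)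
  rw [h2, h2, h1, h1, Fin.sum_univ_succ]
  generalize (∑ i : Fin n, x i.succ • e i) = v at *
  generalize (∑ i : Fin n, y i.succ • e i) = w at *
  have h4 : (2 * (x 0 * y 0 + ∑ i : Fin n, x i.succ * y i.succ)) • (1 : Cl n) =
      (2 * (x 0 * y 0)) • (1 : Cl n) - (v * w + w * v) := by
    rw [h3, ← sub_smul]
    congr 1
    ring
  rw [h4]
  simp only [mul_sub, add_mul, smul_mul_assoc, mul_smul_comm, one_mul, mul_one]
  module

lemma para_mul_cbar (x : Fin (n + 1) → ℝ) :
    para x * para (cbar x) = (∑ i, x i ^ 2) • (1 : Cl n) := by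
  have h := para_mul_cbar_add x x
  rw [← two_smul ℝ, mul_smul] at h
  have h2 := smul_right_injective (Cl n) (two_ne_zero (α := ℝ)) h
  simpa only [pow_two] using h2

lemma cbar_mul_para (x : Fin (n + 1) → ℝ) :
    para (cbar x) * para x = (∑ i, x i ^ 2) • (1 : Cl n) := by
  have h := para_mul_cbar (cbar x)
  rwa [cbar_cbar, sum_sq_cbar] at h

lemma para_mul_para_mul_para (q x : Fin (n + 1) → ℝ) :
    ∃ y, para q * para x * para q = para y := by
  refine ⟨(2 * ∑ i, q i * cbar x i) • q - (∑ i, q i ^ 2) • cbar x, ?_⟩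
  have h1 := para_mul_cbar_add q (cbar x)
  have h2 := cbar_mul_para q
  rw [cbar_cbar] at h1
  rw [sub_eq_add_neg, ← neg_smul, para_add, para_smul, para_smul, eq_sub_of_add_eq h1, sub_mul,
    mul_assoc, h2]
  simp [sub_eq_add_neg]

/-- The properties of products of nonzero paravectors that are used: `a * conj a` is a positive
scalar, and twisted conjugation by `a` preserves paravectors. -/
lemma IsProdOfParavectors.exists_scalar {a : Cl n} (ha : IsProdOfParavectors a) :
    ∃ r : ℝ, 0 < r ∧ a * conj a = r • (1 : Cl n) ∧ conj a * a = r • (1 : Cl n) ∧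
      ∀ x, ∃ y, involute a * para x * conj a = para y := by
  obtain ⟨l, hl, rfl⟩ := ha
  induction l with
  | nil =>
    refine ⟨1, one_pos, ?_, ?_, fun x => ⟨x, ?_⟩⟩ <;>
      simp [one_def, conj_one, involute_one]
  | cons p l ih =>
    obtain ⟨r, hr, h1, h2, h3⟩ := ih fun x hx => hl x (List.mem_cons_of_mem _ hx)
    rw [List.foldr_cons, mul_def]
    set b := List.foldr (fun x b => mul (para x) b) one l
    have hp : 0 < ∑ i, p i ^ 2 := by
      obtain ⟨i, hi⟩ := Function.ne_iff.mp (hl p List.mem_cons_self)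
      exact Finset.sum_pos' (fun j _ => sq_nonneg _) ⟨i, Finset.mem_univ i, sq_pos_of_ne_zero hi⟩
    refine ⟨(∑ i, p i ^ 2) * r, by positivity, ?_, ?_, fun x => ?_⟩
    · rw [conj_mul, mul_assoc, ← mul_assoc b, h1, conj_para, smul_mul_assoc, one_mul,
        mul_smul_comm, para_mul_cbar, smul_smul, mul_comm]
    · rw [conj_mul, mul_assoc, ← mul_assoc _ (para p), conj_para, cbar_mul_para, smul_mul_assoc,
        one_mul, mul_smul_comm, h2, smul_smul]
    · obtain ⟨y, hy⟩ := h3 x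
      obtain ⟨z, hz⟩ := para_mul_para_mul_para (cbar p) y
      refine ⟨z, ?_⟩
      rw [← hz, ← hy, conj_mul, involute_mul, involute_para, conj_para]
      simp only [mul_assoc]

lemma inv_eq_of_mul_eq_one {a b : Cl n} (h1 : a * b = 1) (h2 : b * a = 1) : inv a = b := by
  have h : IsInvertible a := ⟨b, h1, h2⟩
  have h3 : inv a = h.choose := dif_pos h
  rw [h3]
  have h4 : h.choose * a = 1 := h.choose_spec.2
  calc h.choose = h.choose * (a * b) := by rw [h1, mul_one]
    _ = b := by rw [← mul_assoc, h4, one_mul]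

lemma inv_eq_smul_conj {a : Cl n} {r : ℝ} (hr : r ≠ 0) (h1 : a * conj a = r • (1 : Cl n))
    (h2 : conj a * a = r • (1 : Cl n)) : inv a = r⁻¹ • conj a := by
  refine inv_eq_of_mul_eq_one ?_ ?_
  · rw [mul_smul_comm, h1, smul_smul, inv_mul_cancel₀ hr, one_smul]
  · rw [smul_mul_assoc, h2, smul_smul, inv_mul_cancel₀ hr, one_smul]

lemma reverse_mul_involute {a : Cl n} {r : ℝ} (h : conj a * a = r • (1 : Cl n)) :
    reverse a * involute a = r • (1 : Cl n) := by
  rw [reverse_eq, conj_involute, ← involute_mul, h, involute_smul, involute_one]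

lemma memSub.mul {a b : Cl n} {i : Fin n} (ha : memSub a i) (hb : memSub b i) :
    memSub (a * b) i := by
  intro C hC
  rw [← mul_def, coeff_mul]
  refine Finset.sum_eq_zero fun A _ => ?_
  by_cases hA : i ∈ A
  · rw [ha A hA]
    ring
  · rw [hb (A ∆ C) (by simp [Finset.mem_symmDiff, hA, hC])]
    ring

lemma memSub.conj {a : Cl n} {i : Fin n} (ha : memSub a i) : memSub (conj a) i := by
  intro A hA
  rw [coeff_conj, ha A hA, mul_zero]

lemma memSub.smul {a : Cl n} {i : Fin n} (ha : memSub a i) (r : ℝ) : memSub (r • a) i := by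
  intro A hA
  rw [coeff_smul, ha A hA, mul_zero]

lemma memSub.paraCoord_last {n : ℕ} {a : Cl (n + 1)} (ha : memSub a (Fin.last n)) :
    paraCoord a (Fin.last (n + 1)) = 0 :=
  ha {Fin.last n} (Finset.mem_singleton_self _)

lemma involute_mul_e_last {n : ℕ} {a : Cl (n + 1)} (ha : memSub a (Fin.last n)) :
    involute a * e (Fin.last n) = e (Fin.last n) * a := by
  refine ext_coeff fun D => ?_
  rw [← mul_def, ← mul_def, coeff_mul, coeff_mul, Finset.sum_eq_single ({Fin.last n} ∆ D),
    Finset.sum_eq_single {Fin.last n}]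
  · rw [symmDiff_symmDiff_cancel_right, coeff_e, if_pos rfl, coeff_involute]
    by_cases h : Fin.last n ∈ {Fin.last n} ∆ D
    · rw [ha _ h]
      ring
    · have h1 : mulSign ({Fin.last n} ∆ D) {Fin.last n} = 1 := by
        rw [mulSign_eq_prod]
        refine Finset.prod_eq_one fun i hi => ?_
        rw [Finset.prod_singleton, if_neg]
        intro hle
        rw [Fin.last_le_iff.mp hle] at hi
        exact h hi
      have h2 : mulSign {Fin.last n} ({Fin.last n} ∆ D) = ∏ _i ∈ {Fin.last n} ∆ D, (-1 : ℝ) := by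
        rw [mulSign_eq_prod, Finset.prod_singleton]
        exact Finset.prod_congr rfl fun i _ => if_pos (Fin.le_last i)
      rw [h1, h2]
      ring
  · intro A _ hA
    rw [coeff_e, if_neg hA]
    ring
  · simp
  · intro A _ hA
    rw [coeff_e, if_neg]
    · ring
    · intro h
      apply hA
      rw [← h, symmDiff_symmDiff_cancel_right]
  · simp

/-- Twisted conjugation `x ↦ (involute a) x (conj a)` on paravector coordinates. -/
def twist (a : Cl n) : (Fin (n + 1) → ℝ) →ₗ[ℝ] (Fin (n + 1) → ℝ) where
  toFun x := paraCoord (involute a * para x * conj a)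
  map_add' x y := by rw [para_add, mul_add, add_mul, paraCoord_add]
  map_smul' r x := by
    rw [para_smul, mul_smul_comm, smul_mul_assoc, paraCoord_smul, RingHom.id_apply]

lemma para_twist {a : Cl n} (h : ∀ x, ∃ y, involute a * para x * conj a = para y)
    (x : Fin (n + 1) → ℝ) : para (twist a x) = involute a * para x * conj a := by
  obtain ⟨y, hy⟩ := h x
  change para (paraCoord _) = _
  rw [hy, paraCoord_para]

lemma smul_one_injective {r s : ℝ} (h : r • (1 : Cl n) = s • (1 : Cl n)) : r = s :=
  smul_left_injective ℝ one_ne_zero' h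

lemma sum_sq_twist {a : Cl n} {r : ℝ} (h1 : a * conj a = r • (1 : Cl n))
    (h2 : conj a * a = r • (1 : Cl n))
    (h : ∀ x, ∃ y, involute a * para x * conj a = para y) (x : Fin (n + 1) → ℝ) :
    ∑ i, twist a x i ^ 2 = r ^ 2 * ∑ i, x i ^ 2 := by
  apply smul_one_injective (n := n)
  have h3 : involute a * conj (involute a) = r • (1 : Cl n) := by
    rw [conj_involute, ← involute_mul, h1, involute_smul, involute_one]
  rw [← para_mul_cbar, ← conj_para, para_twist h, conj_mul, conj_mul, conj_conj, conj_para]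
  calc involute a * para x * conj a * (a * (para (cbar x) * conj (involute a)))
      = involute a * para x * (conj a * a) * para (cbar x) * conj (involute a) := by
        simp only [mul_assoc]
    _ = r • (involute a * (para x * para (cbar x)) * conj (involute a)) := by
        rw [h2]
        simp only [mul_smul_comm, smul_mul_assoc, mul_one, mul_assoc]
    _ = (r ^ 2 * ∑ i, x i ^ 2) • (1 : Cl n) := by
        rw [para_mul_cbar, mul_smul_comm, mul_one, smul_mul_assoc, h3, smul_smul, smul_smul]
        congr 1
        ring

lemma twist_last {n : ℕ} {a : Cl (n + 1)} (ha : memSub a (Fin.last n)) {r : ℝ}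
    (h1 : a * conj a = r • (1 : Cl (n + 1))) :
    twist a (Pi.single (Fin.last (n + 1)) 1) = r • Pi.single (Fin.last (n + 1)) 1 := by
  change paraCoord _ = _
  rw [← Fin.succ_last, para_single_succ, involute_mul_e_last ha, mul_assoc, h1, mul_smul_comm,
    mul_one, paraCoord_smul, ← para_single_succ, paraCoord_para]

end Algebra

end Cl

namespace Cl

section Analysis

open Topology Filter

variable {N : ℕ}

lemma pderiv_congr {f g : (Fin N → ℝ) → ℝ} {x : Fin N → ℝ} (h : f =ᶠ[𝓝 x] g) (i : Fin N) :
    pderiv i f x = pderiv i g x := by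
  rw [pderiv, pderiv, h.fderiv_eq]

lemma pderiv_eventuallyEq {f g : (Fin N → ℝ) → ℝ} {x : Fin N → ℝ} (h : f =ᶠ[𝓝 x] g)
    (i : Fin N) : pderiv i f =ᶠ[𝓝 x] pderiv i g :=
  h.eventuallyEq_nhds.mono fun _ hy => pderiv_congr hy i

lemma lap_congr {f g : (Fin N → ℝ) → ℝ} {x : Fin N → ℝ} (h : f =ᶠ[𝓝 x] g) :
    lap f x = lap g x :=
  Finset.sum_congr rfl fun i _ => pderiv_congr (pderiv_eventuallyEq h i) i

lemma pderiv_mul {f g : (Fin N → ℝ) → ℝ} {x : Fin N → ℝ} (hf : DifferentiableAt ℝ f x)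
    (hg : DifferentiableAt ℝ g x) (i : Fin N) :
    pderiv i (fun y => f y * g y) x = pderiv i f x * g x + f x * pderiv i g x := by
  simp only [pderiv]
  rw [fderiv_fun_mul hf hg]
  simp only [add_apply, smul_apply, smul_eq_mul]
  ring

lemma pderiv_add {f g : (Fin N → ℝ) → ℝ} {x : Fin N → ℝ} (hf : DifferentiableAt ℝ f x)
    (hg : DifferentiableAt ℝ g x) (i : Fin N) :
    pderiv i (fun y => f y + g y) x = pderiv i f x + pderiv i g x := by
  simp only [pderiv]
  rw [fderiv_fun_add hf hg, add_apply]

lemma pderiv_sum {ι : Type*} (s : Finset ι) {f : ι → (Fin N → ℝ) → ℝ} {x : Fin N → ℝ}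
    (hf : ∀ j ∈ s, DifferentiableAt ℝ (f j) x) (i : Fin N) :
    pderiv i (fun y => ∑ j ∈ s, f j y) x = ∑ j ∈ s, pderiv i (f j) x := by
  simp only [pderiv]
  rw [fderiv_fun_sum hf, sum_apply]

lemma pderiv_const (c : ℝ) (i : Fin N) (x : Fin N → ℝ) : pderiv i (fun _ => c) x = 0 := by
  simp [pderiv]

lemma pderiv_coord (i j : Fin N) (x : Fin N → ℝ) :
    pderiv i (fun y => y j) x = if j = i then 1 else 0 := by
  rw [pderiv, (hasFDerivAt_apply j x).fderiv, ContinuousLinearMap.proj_apply, Pi.single_apply]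

lemma pderiv_scalar_comp {h : ℝ → ℝ} {h' : ℝ} {f : (Fin N → ℝ) → ℝ} {x : Fin N → ℝ}
    (hh : HasDerivAt h h' (f x)) (hf : DifferentiableAt ℝ f x) (i : Fin N) :
    pderiv i (fun y => h (f y)) x = h' * pderiv i f x := by
  have := hh.comp_hasFDerivAt x hf.hasFDerivAt
  rw [pderiv, pderiv]
  erw [this.fderiv]
  simp

lemma pderiv_comp {u : (Fin N → ℝ) → ℝ} {φ : (Fin N → ℝ) → Fin N → ℝ} {x : Fin N → ℝ}
    (hu : DifferentiableAt ℝ u (φ x)) (hφ : DifferentiableAt ℝ φ x) (i : Fin N) :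
    pderiv i (fun y => u (φ y)) x =
      ∑ j, pderiv j u (φ x) * pderiv i (fun y => φ y j) x := by
  have h1 : ∀ j, pderiv i (fun y => φ y j) x = fderiv ℝ φ x (Pi.single i 1) j := by
    intro j
    have h := (hasFDerivAt_pi'.mp hφ.hasFDerivAt j).fderiv
    rw [pderiv, h]
    rfl
  have h2 : pderiv i (fun y => u (φ y)) x = fderiv ℝ u (φ x) (fderiv ℝ φ x (Pi.single i 1)) := by
    rw [pderiv]
    have h := (hu.hasFDerivAt.comp x hφ.hasFDerivAt).fderiv
    erw [h]
    rfl
  rw [h2, pi_eq_sum_univ' (fderiv ℝ φ x (Pi.single i 1)), map_sum]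
  refine Finset.sum_congr rfl fun j _ => ?_
  rw [h1, map_smul, smul_eq_mul, mul_comm, pderiv]

lemma contDiffOn_pderiv {f : (Fin N → ℝ) → ℝ} {s : Set (Fin N → ℝ)} (hs : IsOpen s)
    (hf : ContDiffOn ℝ (⊤ : ℕ∞) f s) (i : Fin N) : ContDiffOn ℝ (⊤ : ℕ∞) (pderiv i f) s :=
  (hf.fderiv_of_isOpen hs (m := (⊤ : ℕ∞)) (by exact_mod_cast le_top)).clm_apply contDiffOn_const

lemma differentiableAt_of_contDiffOn {E : Type*} [NormedAddCommGroup E] [NormedSpace ℝ E]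
    {f : (Fin N → ℝ) → E} {s : Set (Fin N → ℝ)}
    (hs : IsOpen s) (hf : ContDiffOn ℝ (⊤ : ℕ∞) f s) {x : Fin N → ℝ} (hx : x ∈ s) :
    DifferentiableAt ℝ f x :=
  (hf.contDiffAt (hs.mem_nhds hx)).differentiableAt (by simp)

/-- First order product and chain rule for `g · (u ∘ φ)`. -/
lemma pderiv_mul_comp {s t : Set (Fin N → ℝ)} (hs : IsOpen s) (ht : IsOpen t)
    {g u : (Fin N → ℝ) → ℝ} {φ : (Fin N → ℝ) → Fin N → ℝ}
    (hg : ContDiffOn ℝ (⊤ : ℕ∞) g s) (hφ : ContDiffOn ℝ (⊤ : ℕ∞) φ s)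
    (hu : ContDiffOn ℝ (⊤ : ℕ∞) u t) (hm : Set.MapsTo φ s t) {x : Fin N → ℝ} (hx : x ∈ s)
    (i : Fin N) :
    pderiv i (fun y => g y * u (φ y)) x = pderiv i g x * u (φ x) +
      g x * ∑ j, pderiv j u (φ x) * pderiv i (fun y => φ y j) x := by
  have h1 := differentiableAt_of_contDiffOn hs hg hx
  have h2 := differentiableAt_of_contDiffOn hs hφ hx
  have h3 := differentiableAt_of_contDiffOn ht hu (hm hx)
  rw [pderiv_mul h1 (h3.fun_comp' x h2), pderiv_comp h3 h2]

/-- Second order product and chain rule for `g · (u ∘ φ)`. -/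
lemma lap_mul_comp {s t : Set (Fin N → ℝ)} (hs : IsOpen s) (ht : IsOpen t)
    {g u : (Fin N → ℝ) → ℝ} {φ : (Fin N → ℝ) → Fin N → ℝ}
    (hg : ContDiffOn ℝ (⊤ : ℕ∞) g s) (hφ : ContDiffOn ℝ (⊤ : ℕ∞) φ s)
    (hu : ContDiffOn ℝ (⊤ : ℕ∞) u t) (hm : Set.MapsTo φ s t) {x : Fin N → ℝ} (hx : x ∈ s) :
    lap (fun y => g y * u (φ y)) x = lap g x * u (φ x) +
      ∑ j, (2 * ∑ i, pderiv i g x * pderiv i (fun y => φ y j) x +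
        g x * lap (fun y => φ y j) x) * pderiv j u (φ x) +
      g x * ∑ j, ∑ l, (∑ i, pderiv i (fun y => φ y j) x * pderiv i (fun y => φ y l) x) *
        pderiv l (pderiv j u) (φ x) := by
  have hφj : ∀ j, ContDiffOn ℝ (⊤ : ℕ∞) (fun y => φ y j) s := fun j => contDiffOn_pi.mp hφ j
  have hc : ∀ j i, ContDiffOn ℝ (⊤ : ℕ∞)
      (fun y => g y * pderiv i (fun y => φ y j) y) s := fun j i =>
    hg.mul (contDiffOn_pderiv hs (hφj j) i)
  have key : ∀ i, pderiv i (pderiv i (fun y => g y * u (φ y))) x =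
      pderiv i (pderiv i g) x * u (φ x) +
      ∑ j, (2 * (pderiv i g x * pderiv i (fun y => φ y j) x) +
        g x * pderiv i (pderiv i (fun y => φ y j)) x) * pderiv j u (φ x) +
      ∑ j, ∑ l, g x * ((pderiv i (fun y => φ y j) x * pderiv i (fun y => φ y l) x) *
        pderiv l (pderiv j u) (φ x)) := by
    intro i
    have e1 : pderiv i (fun y => g y * u (φ y)) =ᶠ[𝓝 x] fun y => pderiv i g y * u (φ y) +
        ∑ j, (g y * pderiv i (fun y => φ y j) y) * pderiv j u (φ y) := by
      filter_upwards [hs.mem_nhds hx] with y hy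
      rw [pderiv_mul_comp hs ht hg hφ hu hm hy, Finset.mul_sum]
      congr 1
      exact Finset.sum_congr rfl fun j _ => by ring
    have d1 : ∀ j, ContDiffOn ℝ (⊤ : ℕ∞)
        (fun y => (g y * pderiv i (fun y => φ y j) y) * pderiv j u (φ y)) s := fun j =>
      (hc j i).mul ((contDiffOn_pderiv ht hu j).comp hφ hm)
    have d2 : ContDiffOn ℝ (⊤ : ℕ∞) (fun y => pderiv i g y * u (φ y)) s :=
      (contDiffOn_pderiv hs hg i).mul (hu.comp hφ hm)
    have d3 : ∀ j ∈ Finset.univ, DifferentiableAt ℝ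
        (fun y => (g y * pderiv i (fun y => φ y j) y) * pderiv j u (φ y)) x :=
      fun j _ => differentiableAt_of_contDiffOn hs (d1 j) hx
    rw [pderiv_congr e1, pderiv_add (differentiableAt_of_contDiffOn hs d2 hx)
      (DifferentiableAt.fun_sum d3),
      pderiv_mul_comp hs ht (contDiffOn_pderiv hs hg i) hφ hu hm hx, pderiv_sum _ d3,
      Finset.mul_sum, add_assoc, add_assoc, ← Finset.sum_add_distrib, ← Finset.sum_add_distrib]
    congr 1
    refine Finset.sum_congr rfl fun j _ => ?_
    rw [pderiv_mul_comp hs ht (hc j i) hφ (contDiffOn_pderiv ht hu j) hm hx,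
      pderiv_mul (differentiableAt_of_contDiffOn hs hg hx)
      (differentiableAt_of_contDiffOn hs (contDiffOn_pderiv hs (hφj j) i) hx), Finset.mul_sum]
    have : ∑ l, g x * pderiv i (fun y => φ y j) x *
        (pderiv l (pderiv j u) (φ x) * pderiv i (fun y => φ y l) x) =
        ∑ l, g x * ((pderiv i (fun y => φ y j) x * pderiv i (fun y => φ y l) x) *
        pderiv l (pderiv j u) (φ x)) := Finset.sum_congr rfl fun l _ => by ring
    rw [this]
    ring
  rw [lap, Finset.sum_congr rfl fun i _ => key i, Finset.sum_add_distrib, Finset.sum_add_distrib,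
    ← Finset.sum_mul]
  congr 1
  · congr 1
    rw [Finset.sum_comm]
    refine Finset.sum_congr rfl fun j _ => ?_
    rw [← Finset.sum_mul, Finset.sum_add_distrib, ← Finset.mul_sum, ← Finset.mul_sum]
    rfl
  · rw [Finset.sum_comm, Finset.mul_sum]
    refine Finset.sum_congr rfl fun j _ => ?_
    rw [Finset.sum_comm, Finset.mul_sum]
    refine Finset.sum_congr rfl fun l _ => ?_
    rw [← Finset.mul_sum, Finset.sum_mul]

/-- Smooth solutions of the `k`-hyperbolic harmonic equation on upper half-space. -/
def IsHypHarmonic {n : ℕ} (k : ℝ) (u : (Fin (n + 1) → ℝ) → ℝ) : Prop :=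
  ContDiffOn ℝ (⊤ : ℕ∞) u (upperHalf n) ∧
    ∀ x ∈ upperHalf n, x (Fin.last n) * lap u x - k * pderiv (Fin.last n) u x = 0

variable {n : ℕ}

lemma isOpen_upperHalf : IsOpen (upperHalf n) :=
  isOpen_lt continuous_const (continuous_apply _)

lemma IsHypHarmonic.congr {k : ℝ} {u v : (Fin (n + 1) → ℝ) → ℝ} (hu : IsHypHarmonic k u)
    (h : ∀ x ∈ upperHalf n, v x = u x) : IsHypHarmonic k v := by
  refine ⟨hu.1.congr h, fun x hx => ?_⟩
  have e : v =ᶠ[𝓝 x] u := by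
    filter_upwards [isOpen_upperHalf.mem_nhds hx] with y hy using h y hy
  rw [lap_congr e, pderiv_congr e]
  exact hu.2 x hx

/-- A criterion for the operator `u ↦ g · (u ∘ φ)` with `φ` conformal to preserve solutions
of the `k`-hyperbolic harmonic equation. -/
lemma IsHypHarmonic.mul_comp {k : ℝ} {u g μ : (Fin (n + 1) → ℝ) → ℝ}
    {φ : (Fin (n + 1) → ℝ) → Fin (n + 1) → ℝ} (hu : IsHypHarmonic k u)
    (hg : ContDiffOn ℝ (⊤ : ℕ∞) g (upperHalf n)) (hφ : ContDiffOn ℝ (⊤ : ℕ∞) φ (upperHalf n))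
    (hμ : ∀ x ∈ upperHalf n, 0 < μ x)
    (hlast : ∀ x ∈ upperHalf n, φ x (Fin.last n) = μ x * x (Fin.last n))
    (hconf : ∀ x ∈ upperHalf n, ∀ j l,
      ∑ i, pderiv i (fun y => φ y j) x * pderiv i (fun y => φ y l) x =
        if j = l then μ x ^ 2 else 0)
    (hfirst : ∀ x ∈ upperHalf n, ∀ j,
      x (Fin.last n) * (2 * ∑ i, pderiv i g x * pderiv i (fun y => φ y j) x +
        g x * lap (fun y => φ y j) x) - k * (g x * pderiv (Fin.last n) (fun y => φ y j) x) =
        if j = Fin.last n then -(k * (g x * μ x)) else 0)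
    (hg0 : ∀ x ∈ upperHalf n, x (Fin.last n) * lap g x - k * pderiv (Fin.last n) g x = 0) :
    IsHypHarmonic k (fun y => g y * u (φ y)) := by
  have hm : Set.MapsTo φ (upperHalf n) (upperHalf n) := fun x hx => by
    change 0 < φ x (Fin.last n)
    rw [hlast x hx]
    exact mul_pos (hμ x hx) hx
  refine ⟨hg.mul (hu.1.comp hφ hm), fun x hx => ?_⟩
  rw [lap_mul_comp isOpen_upperHalf isOpen_upperHalf hg hφ hu.1 hm hx,
    pderiv_mul_comp isOpen_upperHalf isOpen_upperHalf hg hφ hu.1 hm hx]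
  have h1 : ∑ j, ∑ l, (∑ i, pderiv i (fun y => φ y j) x * pderiv i (fun y => φ y l) x) *
      pderiv l (pderiv j u) (φ x) = μ x ^ 2 * lap u (φ x) := by
    simp only [hconf x hx, ite_mul, zero_mul, Finset.sum_ite_eq, Finset.mem_univ, if_true,
      ← Finset.mul_sum]
    rfl
  have h2 : x (Fin.last n) * (∑ j, (2 * ∑ i, pderiv i g x * pderiv i (fun y => φ y j) x +
        g x * lap (fun y => φ y j) x) * pderiv j u (φ x)) -
      k * (g x * ∑ j, pderiv j u (φ x) * pderiv (Fin.last n) (fun y => φ y j) x) =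
      -(k * (g x * μ x)) * pderiv (Fin.last n) u (φ x) := by
    have : ∀ j, (x (Fin.last n) * (2 * ∑ i, pderiv i g x * pderiv i (fun y => φ y j) x +
        g x * lap (fun y => φ y j) x) - k * (g x * pderiv (Fin.last n) (fun y => φ y j) x)) *
        pderiv j u (φ x) =
        if j = Fin.last n then -(k * (g x * μ x)) * pderiv (Fin.last n) u (φ x) else 0 := by
      intro j
      rw [hfirst x hx j]
      split_ifs with h
      · rw [h]
      · rw [zero_mul]
    have h3 := Finset.sum_congr (rfl : (Finset.univ : Finset (Fin (n + 1))) = Finset.univ)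
      (fun j _ => this j)
    rw [Finset.sum_ite_eq' Finset.univ (Fin.last n), if_pos (Finset.mem_univ _)] at h3
    rw [← h3, Finset.mul_sum, Finset.mul_sum, Finset.mul_sum, ← Finset.sum_sub_distrib]
    exact Finset.sum_congr rfl fun j _ => by ring
  have h4 := hu.2 (φ x) (hm hx)
  rw [hlast x hx] at h4
  rw [h1]
  linear_combination u (φ x) * hg0 x hx + h2 + g x * μ x * h4

lemma sum_mul_of_sum_sq {B : (Fin N → ℝ) →ₗ[ℝ] (Fin N → ℝ)} {c : ℝ} (hc : 0 < c)
    (hB : ∀ x, ∑ i, B x i ^ 2 = c ^ 2 * ∑ i, x i ^ 2) (j l : Fin N) :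
    ∑ i, B (Pi.single i 1) j * B (Pi.single i 1) l = if j = l then c ^ 2 else 0 := by
  have h1 : ∀ x y, ∑ i, B x i * B y i = c ^ 2 * ∑ i, x i * y i := by
    intro x y
    have h := hB (x + y)
    simp only [map_add, Pi.add_apply, add_sq, Finset.sum_add_distrib, mul_add, hB x, hB y] at h
    have e1 : ∑ i, 2 * B x i * B y i = 2 * ∑ i, B x i * B y i := by
      rw [Finset.mul_sum]
      exact Finset.sum_congr rfl fun i _ => by ring
    have e2 : ∑ i, 2 * x i * y i = 2 * ∑ i, x i * y i := by
      rw [Finset.mul_sum]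
      exact Finset.sum_congr rfl fun i _ => by ring
    rw [e1, e2] at h
    linarith
  set A : Matrix (Fin N) (Fin N) ℝ := Matrix.of fun j i => B (Pi.single i 1) j with hA
  have h2 : ((c ^ 2)⁻¹ • A.transpose) * A = 1 := by
    ext i l
    rw [Matrix.smul_mul, Matrix.smul_apply, Matrix.mul_apply]
    have := h1 (Pi.single i 1) (Pi.single l 1)
    simp only [hA, Matrix.transpose_apply, Matrix.of_apply]
    rw [this, smul_eq_mul, inv_mul_cancel_left₀ (by positivity), Matrix.one_apply]
    simp [Pi.single_apply, eq_comm]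
  have h3 := congrArg (fun M : Matrix (Fin N) (Fin N) ℝ => M j l) (mul_eq_one_comm.mp h2)
  rw [Matrix.mul_smul, Matrix.smul_apply, Matrix.mul_apply, smul_eq_mul,
    inv_mul_eq_iff_eq_mul₀ (by positivity), Matrix.one_apply] at h3
  simp only [hA, Matrix.transpose_apply, Matrix.of_apply] at h3
  rw [h3]
  split_ifs <;> simp

/-- Invariance under similarities of upper half-space. -/
lemma IsHypHarmonic.comp_similarity {k : ℝ} {u : (Fin (n + 1) → ℝ) → ℝ} (hu : IsHypHarmonic k u)
    (B : (Fin (n + 1) → ℝ) →ₗ[ℝ] (Fin (n + 1) → ℝ)) {c : ℝ} (hc : 0 < c)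
    (hB : ∀ x, ∑ i, B x i ^ 2 = c ^ 2 * ∑ i, x i ^ 2)
    (hlast : B (Pi.single (Fin.last n) 1) = c • Pi.single (Fin.last n) 1)
    (s : Fin (n + 1) → ℝ) (hs : s (Fin.last n) = 0) (C : ℝ) :
    IsHypHarmonic k (fun y => C * u (s + B y)) := by
  have horth := sum_mul_of_sum_sq hc hB
  have hp : ∀ i j x, pderiv i (fun y => (s + B y) j) x = B (Pi.single i 1) j := by
    intro i j x
    have h : HasFDerivAt (fun y => (s + B y) j)
        ((ContinuousLinearMap.proj j).comp (LinearMap.toContinuousLinearMap B)) x :=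
      (((ContinuousLinearMap.proj (R := ℝ) (φ := fun _ : Fin (n + 1) => ℝ) j).comp
        (LinearMap.toContinuousLinearMap B)).hasFDerivAt (x := x)).const_add (s j)
    rw [pderiv, h.fderiv]
    rfl
  have hpl : ∀ j x, lap (fun y => (s + B y) j) x = 0 := by
    intro j x
    refine Finset.sum_eq_zero fun i _ => ?_
    rw [show pderiv i (fun y => (s + B y) j) = fun _ => B (Pi.single i 1) j from
      funext (hp i j), pderiv_const]
  have hcl : ∀ x, lap (fun _ : Fin (n + 1) → ℝ => C) x = 0 := by
    intro x
    refine Finset.sum_eq_zero fun i _ => ?_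
    rw [show pderiv i (fun _ : Fin (n + 1) → ℝ => C) = fun _ => 0 from
      funext (pderiv_const C i), pderiv_const]
  have hBn : ∀ x, B x (Fin.last n) = c * x (Fin.last n) := by
    intro x
    have h1 : ∀ i, B (Pi.single i 1) (Fin.last n) = if i = Fin.last n then c else 0 := by
      intro i
      have h2 := horth (Fin.last n) (Fin.last n)
      rw [if_pos rfl, ← Finset.add_sum_erase _ _ (Finset.mem_univ (Fin.last n)), hlast] at h2
      simp only [Pi.smul_apply, Pi.single_eq_same, smul_eq_mul, mul_one] at h2
      have h3 : ∑ i ∈ Finset.univ.erase (Fin.last n),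
          B (Pi.single i 1) (Fin.last n) * B (Pi.single i 1) (Fin.last n) = 0 := by linarith
      rw [Finset.sum_eq_zero_iff_of_nonneg fun i _ => mul_self_nonneg _] at h3
      split_ifs with h
      · simp [h, hlast]
      · exact mul_self_eq_zero.mp (h3 i (Finset.mem_erase.mpr ⟨h, Finset.mem_univ i⟩))
    conv_lhs => rw [← Finset.univ_sum_single x]
    rw [map_sum, Finset.sum_apply]
    have h4 : ∀ i, B (Pi.single i (x i)) (Fin.last n) = x i * B (Pi.single i 1) (Fin.last n) := by
      intro i
      have : (Pi.single i (x i) : Fin (n + 1) → ℝ) = x i • Pi.single i 1 := by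
        rw [← Pi.single_smul, smul_eq_mul, mul_one]
      rw [this, map_smul, Pi.smul_apply, smul_eq_mul]
    simp only [h4, h1, mul_ite, mul_zero, Finset.sum_ite_eq', Finset.mem_univ, if_true]
    ring
  refine hu.mul_comp (μ := fun _ => c) (g := fun _ => C) (φ := fun y => s + B y)
    contDiffOn_const ?_ (fun _ _ => hc) ?_ ?_ ?_ ?_
  · exact (contDiff_const.add (LinearMap.toContinuousLinearMap B).contDiff).contDiffOn
  · intro x _
    rw [Pi.add_apply, hs, hBn, zero_add]
  · intro x _ j l
    simp only [hp, horth]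
  · intro x _ j
    simp only [hp, hpl, pderiv_const, hlast]
    rw [Pi.smul_apply, Pi.single_apply]
    split_ifs <;> simp
  · intro x _
    simp only [hcl, pderiv_const]
    ring

lemma differentiableAt_sum_sq (x : Fin N → ℝ) :
    DifferentiableAt ℝ (fun y : Fin N → ℝ => ∑ i, y i ^ 2) x := by
  fun_prop

lemma differentiableAt_rpow_sum_sq (q : ℝ) {x : Fin N → ℝ} (hx : 0 < ∑ i, x i ^ 2) :
    DifferentiableAt ℝ (fun y : Fin N → ℝ => (∑ i, y i ^ 2) ^ q) x :=
  (differentiableAt_sum_sq x).rpow_const (Or.inl hx.ne')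

lemma pderiv_sum_sq (i : Fin N) (x : Fin N → ℝ) :
    pderiv i (fun y : Fin N → ℝ => ∑ j, y j ^ 2) x = 2 * x i := by
  rw [pderiv_sum _ (fun j _ => by fun_prop)]
  have : ∀ j, pderiv i (fun y : Fin N → ℝ => y j ^ 2) x = if j = i then 2 * x i else 0 := by
    intro j
    have h := pderiv_scalar_comp (h := fun t => t ^ 2) (f := fun y : Fin N → ℝ => y j) (x := x)
      (hasDerivAt_pow 2 (x j)) (differentiableAt_apply j x) i
    rw [h, pderiv_coord]
    split_ifs with hji <;> simp [hji]
  simp [this]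

lemma pderiv_rpow_sum_sq (q : ℝ) {x : Fin N → ℝ} (hx : 0 < ∑ i, x i ^ 2) (i : Fin N) :
    pderiv i (fun y : Fin N → ℝ => (∑ j, y j ^ 2) ^ q) x =
      2 * q * (x i * (∑ j, x j ^ 2) ^ (q - 1)) := by
  rw [pderiv_scalar_comp (h := fun t => t ^ q) (f := fun y : Fin N → ℝ => ∑ j, y j ^ 2)
    (Real.hasDerivAt_rpow_const (Or.inl hx.ne'))
    (differentiableAt_sum_sq x), pderiv_sum_sq]
  ring

lemma pderiv_coord_mul_rpow (q : ℝ) {x : Fin N → ℝ} (hx : 0 < ∑ i, x i ^ 2) (i j : Fin N) :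
    pderiv i (fun y : Fin N → ℝ => y j * (∑ l, y l ^ 2) ^ q) x =
      (if j = i then 1 else 0) * (∑ l, x l ^ 2) ^ q +
        x j * (2 * q * (x i * (∑ l, x l ^ 2) ^ (q - 1))) := by
  rw [pderiv_mul (differentiableAt_apply j x) (differentiableAt_rpow_sum_sq q hx), pderiv_coord,
    pderiv_rpow_sum_sq q hx]

lemma eventually_sum_sq_pos {x : Fin N → ℝ} (hx : 0 < ∑ i, x i ^ 2) :
    ∀ᶠ y in 𝓝 x, 0 < ∑ i, y i ^ 2 :=
  (differentiableAt_sum_sq x).continuousAt.eventually (lt_mem_nhds hx)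

lemma pderiv_const_mul {f : (Fin N → ℝ) → ℝ} {x : Fin N → ℝ} (c : ℝ)
    (hf : DifferentiableAt ℝ f x) (i : Fin N) :
    pderiv i (fun y => c * f y) x = c * pderiv i f x := by
  rw [pderiv_mul (differentiableAt_const c) hf, pderiv_const, zero_mul, zero_add]

lemma pderiv_pderiv_rpow (q : ℝ) {x : Fin N → ℝ} (hx : 0 < ∑ i, x i ^ 2) (i : Fin N) :
    pderiv i (pderiv i (fun y : Fin N → ℝ => (∑ j, y j ^ 2) ^ q)) x =
      2 * q * ((∑ l, x l ^ 2) ^ (q - 1) +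
        x i ^ 2 * (2 * (q - 1) * (∑ l, x l ^ 2) ^ (q - 1 - 1))) := by
  have e : pderiv i (fun y : Fin N → ℝ => (∑ j, y j ^ 2) ^ q) =ᶠ[𝓝 x]
      fun y => 2 * q * (y i * (∑ j, y j ^ 2) ^ (q - 1)) := by
    filter_upwards [eventually_sum_sq_pos hx] with y hy using pderiv_rpow_sum_sq q hy i
  rw [pderiv_congr e, pderiv_const_mul _
    ((differentiableAt_apply i x).fun_mul (differentiableAt_rpow_sum_sq _ hx)),
    pderiv_coord_mul_rpow _ hx, if_pos rfl]
  ring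

lemma lap_rpow_sum_sq (q : ℝ) {x : Fin N → ℝ} (hx : 0 < ∑ i, x i ^ 2) :
    lap (fun y : Fin N → ℝ => (∑ j, y j ^ 2) ^ q) x =
      2 * q * (N + 2 * (q - 1)) * (∑ l, x l ^ 2) ^ (q - 1) := by
  rw [lap, Finset.sum_congr rfl fun i _ => pderiv_pderiv_rpow q hx i, ← Finset.mul_sum,
    Finset.sum_add_distrib, ← Finset.sum_mul, Finset.sum_const, Finset.card_univ, Fintype.card_fin,
    nsmul_eq_mul, Real.rpow_sub_one hx.ne' (q - 1)]
  field_simp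

lemma lap_coord_mul_rpow (q : ℝ) {x : Fin N → ℝ} (hx : 0 < ∑ i, x i ^ 2) (j : Fin N) :
    lap (fun y : Fin N → ℝ => y j * (∑ l, y l ^ 2) ^ q) x =
      2 * q * (N + 2 * (q - 1) + 2) * (x j * (∑ l, x l ^ 2) ^ (q - 1)) := by
  have key : ∀ i, pderiv i (pderiv i (fun y : Fin N → ℝ => y j * (∑ l, y l ^ 2) ^ q)) x =
      (if j = i then 2 * (2 * q * (x i * (∑ l, x l ^ 2) ^ (q - 1))) else 0) +
        x j * pderiv i (pderiv i (fun y : Fin N → ℝ => (∑ l, y l ^ 2) ^ q)) x := by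
    intro i
    have e : pderiv i (fun y : Fin N → ℝ => y j * (∑ l, y l ^ 2) ^ q) =ᶠ[𝓝 x]
        fun y => (if j = i then 1 else 0) * (∑ l, y l ^ 2) ^ q +
          2 * q * (y j * (y i * (∑ l, y l ^ 2) ^ (q - 1))) := by
      filter_upwards [eventually_sum_sq_pos hx] with y hy
      rw [pderiv_coord_mul_rpow q hy]
      ring
    have d1 := differentiableAt_rpow_sum_sq q hx
    have d2 : DifferentiableAt ℝ (fun y : Fin N → ℝ => y i * (∑ l, y l ^ 2) ^ (q - 1)) x :=
      (differentiableAt_apply i x).fun_mul (differentiableAt_rpow_sum_sq (q - 1) hx)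
    have d3 : DifferentiableAt ℝ (fun y : Fin N → ℝ => y j * (y i * (∑ l, y l ^ 2) ^ (q - 1))) x :=
      (differentiableAt_apply j x).fun_mul d2
    rw [pderiv_congr e, pderiv_add (d1.const_mul _) (d3.const_mul _), pderiv_const_mul _ d1,
      pderiv_const_mul _ d3, pderiv_mul (differentiableAt_apply j x) d2, pderiv_coord,
      pderiv_coord_mul_rpow _ hx, if_pos rfl, pderiv_rpow_sum_sq q hx, pderiv_pderiv_rpow q hx]
    split_ifs <;> ring
  rw [lap, Finset.sum_congr rfl fun i _ => key i, Finset.sum_add_distrib, ← Finset.mul_sum]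
  change _ + x j * lap (fun y : Fin N → ℝ => (∑ l, y l ^ 2) ^ q) x = _
  rw [lap_rpow_sum_sq q hx, Finset.sum_ite_eq, if_pos (Finset.mem_univ j)]
  ring

lemma sum_sq_pos_of_mem {x : Fin (n + 1) → ℝ} (hx : x ∈ upperHalf n) : 0 < ∑ i, x i ^ 2 :=
  Finset.sum_pos' (fun _ _ => sq_nonneg _) ⟨Fin.last n, Finset.mem_univ _, pow_pos hx 2⟩

/-- Invariance under the inversion in the unit sphere (Kelvin transform). -/
lemma IsHypHarmonic.kelvin {k : ℝ} {u : (Fin (n + 1) → ℝ) → ℝ} (hu : IsHypHarmonic k u) :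
    IsHypHarmonic k (fun y => (∑ i, y i ^ 2) ^ (-((n : ℝ) - k - 1) / 2) *
      u (fun j => y j * (∑ i, y i ^ 2) ^ (-1 : ℝ))) := by
  have hr : ∀ q : ℝ, ContDiffOn ℝ (⊤ : ℕ∞)
      (fun y : Fin (n + 1) → ℝ => (∑ i, y i ^ 2) ^ q) (upperHalf n) := fun q =>
    ContDiffOn.rpow_const_of_ne (ContDiff.contDiffOn (by fun_prop))
      fun x hx => (sum_sq_pos_of_mem hx).ne'
  refine hu.mul_comp (μ := fun y => (∑ i, y i ^ 2)⁻¹)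
    (g := fun y => (∑ i, y i ^ 2) ^ (-((n : ℝ) - k - 1) / 2))
    (φ := fun y j => y j * (∑ i, y i ^ 2) ^ (-1 : ℝ)) (hr _) ?_
    (fun x hx => inv_pos.mpr (sum_sq_pos_of_mem hx)) ?_ ?_ ?_ ?_
  · exact contDiffOn_pi.mpr fun j => (contDiff_apply ℝ ℝ j).contDiffOn.mul (hr _)
  · intro x _
    simp only [Real.rpow_neg_one]
    ring
  · intro x hx j l
    have hx' := sum_sq_pos_of_mem hx
    simp only [pderiv_coord_mul_rpow _ hx']
    simp only [Real.rpow_sub_one hx'.ne', Real.rpow_neg_one]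
    set r := ∑ i, x i ^ 2 with hrdef
    have : ∀ i, ((if j = i then 1 else 0) * r⁻¹ + x j * (2 * -1 * (x i * (r⁻¹ / r)))) *
        ((if l = i then 1 else 0) * r⁻¹ + x l * (2 * -1 * (x i * (r⁻¹ / r)))) =
        (if j = i then (if l = i then 1 else 0) * (r⁻¹) ^ 2 - 2 * r⁻¹ ^ 3 * x l * x i else 0) +
        (if l = i then -2 * r⁻¹ ^ 3 * x j * x i else 0) +
        4 * r⁻¹ ^ 4 * x j * x l * x i ^ 2 := by
      intro i
      split_ifs <;> field_simp <;> ring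
    rw [Finset.sum_congr rfl fun i _ => this i, Finset.sum_add_distrib, Finset.sum_add_distrib,
      Finset.sum_ite_eq, Finset.sum_ite_eq, if_pos (Finset.mem_univ _),
      if_pos (Finset.mem_univ _), ← Finset.mul_sum, ← hrdef]
    simp only [eq_comm (a := l)]
    split_ifs <;> field_simp <;> ring
  · intro x hx j
    have hx' := sum_sq_pos_of_mem hx
    simp only [pderiv_coord_mul_rpow _ hx', pderiv_rpow_sum_sq _ hx', lap_coord_mul_rpow _ hx']
    simp only [Real.rpow_sub_one hx'.ne', Real.rpow_neg_one]
    set p := -((n : ℝ) - k - 1) / 2 with hp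
    set r := ∑ i, x i ^ 2 with hrdef
    have : ∀ i, 2 * p * (x i * (r ^ p / r)) *
        ((if j = i then 1 else 0) * r⁻¹ + x j * (2 * -1 * (x i * (r⁻¹ / r)))) =
        (if j = i then 2 * p * r ^ p * r⁻¹ ^ 2 * x i else 0) +
        (-4 * p * r ^ p * r⁻¹ ^ 3 * x j) * x i ^ 2 := by
      intro i
      split_ifs <;> field_simp <;> ring
    rw [Finset.sum_congr rfl fun i _ => this i, Finset.sum_add_distrib,
      Finset.sum_ite_eq, if_pos (Finset.mem_univ _), ← Finset.mul_sum, ← hrdef]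
    have hk : k = 2 * p + n - 1 := by
      rw [hp]
      ring
    rw [hk]
    push_cast
    split_ifs <;> field_simp <;> ring
  · intro x hx
    have hx' := sum_sq_pos_of_mem hx
    rw [lap_rpow_sum_sq _ hx', pderiv_rpow_sum_sq _ hx']
    push_cast
    ring

end Analysis

end Cl

namespace Cl

section Moebius

variable {m : ℕ}

lemma exists_similarity {a : Cl (m + 1)} (ha : IsProdOfParavectors a)
    (hs : memSub a (Fin.last m)) :
    ∃ r : ℝ, 0 < r ∧ a * conj a = r • (1 : Cl (m + 1)) ∧ conj a * a = r • (1 : Cl (m + 1)) ∧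
      ∃ B : (Fin (m + 2) → ℝ) →ₗ[ℝ] (Fin (m + 2) → ℝ),
        (∀ x, para (B x) = (r⁻¹ * r⁻¹) • (involute a * para x * conj a)) ∧
        (∀ x, ∑ i, B x i ^ 2 = r⁻¹ ^ 2 * ∑ i, x i ^ 2) ∧
        B (Pi.single (Fin.last (m + 1)) 1) = r⁻¹ • Pi.single (Fin.last (m + 1)) 1 := by
  obtain ⟨r, hr, h1, h2, h3⟩ := ha.exists_scalar
  refine ⟨r, hr, h1, h2, (r⁻¹ * r⁻¹) • twist a, fun x => ?_, fun x => ?_, ?_⟩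
  · rw [LinearMap.smul_apply, para_smul, para_twist h3]
  · simp only [LinearMap.smul_apply, Pi.smul_apply, smul_eq_mul, mul_pow]
    rw [← Finset.mul_sum, sum_sq_twist h1 h2 h3]
    field_simp
  · rw [LinearMap.smul_apply, twist_last hs h1, smul_smul]
    congr 1
    field_simp

lemma reverse_mul_involute_inv {c : Cl (m + 1)} {r : ℝ} (hr : 0 < r)
    (h : conj c * c = r • (1 : Cl (m + 1))) {z : Cl (m + 1)} (hz : z * reverse c = 1) :
    z = r⁻¹ • involute c := by
  calc z = r⁻¹ • (z * (r • (1 : Cl (m + 1)))) := by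
        rw [mul_smul_comm, mul_one, smul_smul, inv_mul_cancel₀ hr.ne', one_smul]
    _ = r⁻¹ • involute c := by rw [← reverse_mul_involute h, ← mul_assoc, hz, one_mul]

/-- If `c = 0`, the Möbius transformation is a similarity. -/
lemma SAVsub.moebius_of_c_eq_zero (M : SAVsub m) (hc : M.c = 0) :
    ∃ (r : ℝ) (B : (Fin (m + 2) → ℝ) →ₗ[ℝ] (Fin (m + 2) → ℝ)) (s : Fin (m + 2) → ℝ),
      0 < r ∧ (∀ x, ∑ i, B x i ^ 2 = r ^ 2 * ∑ i, x i ^ 2) ∧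
      B (Pi.single (Fin.last (m + 1)) 1) = r • Pi.single (Fin.last (m + 1)) 1 ∧
      s (Fin.last (m + 1)) = 0 ∧ (∀ x, moebius M.toSAV x = s + B x) ∧
      ∀ x, norm (cxd M.toSAV x) = norm M.d := by
  have hdet : M.a * reverse M.d = 1 := by
    have h := M.det
    rw [hc, reverse_zero, mul_def, mul_def, mul_zero, sub_zero] at h
    exact h
  have hd : M.d ≠ 0 := by
    intro h
    rw [h, reverse_zero, mul_zero] at hdet
    exact one_ne_zero' hdet.symm
  obtain ⟨r, hr, h1, h2, B, hB, hB2, hBl⟩ := exists_similarity (M.prod_d.resolve_left hd) M.sub_d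
  have hcxd : ∀ x, cxd M.toSAV x = M.d := by
    intro x
    rw [cxd, hc, mul_def, zero_mul, zero_add]
  have hinv : inv M.d = r⁻¹ • conj M.d := inv_eq_smul_conj hr.ne' h1 h2
  have ha : M.a = r⁻¹ • involute M.d := reverse_mul_involute_inv hr h2 hdet
  refine ⟨r⁻¹, B, paraCoord (M.b * inv M.d), inv_pos.mpr hr, hB2, hBl, ?_, fun x => ?_,
    fun x => by rw [hcxd]⟩
  · refine (M.sub_b.mul ?_).paraCoord_last
    rw [hinv]
    exact M.sub_d.conj.smul _
  · rw [moebius, moebiusCl, hcxd, axb, mul_def, mul_def, add_mul, add_comm (M.a * para x * inv M.d),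
      paraCoord_add]
    congr 1
    rw [← paraCoord_para (B x), hB, hinv, ha]
    simp only [smul_mul_assoc, mul_smul_comm, smul_smul]

/-- If `c ≠ 0`, the Möbius transformation is a translation followed by the inversion in the unit
sphere and a similarity. -/
lemma SAVsub.moebius_of_c_ne_zero (M : SAVsub m) (hc : M.c ≠ 0) :
    ∃ (r : ℝ) (B : (Fin (m + 2) → ℝ) →ₗ[ℝ] (Fin (m + 2) → ℝ)) (s t : Fin (m + 2) → ℝ),
      0 < r ∧ (∀ x, ∑ i, B x i ^ 2 = r⁻¹ ^ 2 * ∑ i, x i ^ 2) ∧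
      B (Pi.single (Fin.last (m + 1)) 1) = r⁻¹ • Pi.single (Fin.last (m + 1)) 1 ∧
      s (Fin.last (m + 1)) = 0 ∧ t (Fin.last (m + 1)) = 0 ∧
      (∀ x, 0 < ∑ i, (t + x) i ^ 2 →
        moebius M.toSAV x = s + B (fun j => (t + x) j * (∑ i, (t + x) i ^ 2) ^ (-1 : ℝ))) ∧
      ∀ x, norm (cxd M.toSAV x) = Real.sqrt (r * ∑ i, (t + x) i ^ 2) := by
  obtain ⟨r, hr, h1, h2, B, hB, hB2, hBl⟩ := exists_similarity (M.prod_c.resolve_left hc) M.sub_c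
  obtain ⟨t, ht⟩ := (M.cond_c hc).2
  rw [mul_def] at ht
  have hinv : inv M.c = r⁻¹ • conj M.c := inv_eq_smul_conj hr.ne' h1 h2
  have hci : M.c * inv M.c = 1 := by
    rw [hinv, mul_smul_comm, h1, smul_smul, inv_mul_cancel₀ hr.ne', one_smul]
  have hic : inv M.c * M.c = 1 := by
    rw [hinv, smul_mul_assoc, h2, smul_smul, inv_mul_cancel₀ hr.ne', one_smul]
  have hsub : memSub (inv M.c) (Fin.last m) := by
    rw [hinv]
    exact M.sub_c.conj.smul _
  have hd : M.d = M.c * para t := by rw [← ht, ← mul_assoc, hci, one_mul]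
  have hcxd : ∀ x, cxd M.toSAV x = M.c * para (t + x) := by
    intro x
    rw [cxd, mul_def, para_add, mul_add, ← hd, add_comm (M.c * para x)]
  have hcY : ∀ y, (M.c * para y) * conj (M.c * para y) =
      (r * ∑ i, y i ^ 2) • (1 : Cl (m + 1)) := by
    intro y
    rw [conj_mul, mul_assoc, ← mul_assoc (para y), conj_para, para_mul_cbar, smul_mul_assoc,
      one_mul, mul_smul_comm, h1, smul_smul, mul_comm]
  have hdet : (M.a * para t - M.b) * reverse M.c = 1 := by
    have h := M.det
    rw [mul_def, mul_def, hd, reverse_mul, reverse_para] at h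
    rw [sub_mul, mul_assoc]
    exact h
  have hb : M.a * para t - M.b = r⁻¹ • involute M.c := reverse_mul_involute_inv hr h2 hdet
  refine ⟨r, -(B ∘ₗ cbar), paraCoord (M.a * inv M.c), t, hr, fun x => ?_, ?_,
    (M.sub_a.mul hsub).paraCoord_last, ?_, fun x hx => ?_, fun x => ?_⟩
  · simp only [LinearMap.neg_apply, LinearMap.comp_apply, Pi.neg_apply, neg_sq]
    rw [hB2, sum_sq_cbar]
  · have hcb : cbar (Pi.single (Fin.last (m + 1)) 1 : Fin (m + 2) → ℝ) =
        -Pi.single (Fin.last (m + 1)) 1 := by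
      funext i
      refine Fin.cases ?_ (fun i => ?_) i
      · simp
      · simp
    rw [LinearMap.neg_apply, LinearMap.comp_apply, hcb, map_neg, neg_neg, hBl]
  · rw [← paraCoord_para t, ← ht]
    exact (hsub.mul M.sub_d).paraCoord_last
  · set ρ := ∑ i, (t + x) i ^ 2 with hρ
    set y := t + x with hy
    have hI1 : para y * (ρ⁻¹ • para (cbar y)) = 1 := by
      rw [mul_smul_comm, para_mul_cbar, smul_smul, inv_mul_cancel₀ hx.ne', one_smul]
    have hI2 : (ρ⁻¹ • para (cbar y)) * para y = 1 := by
      rw [smul_mul_assoc, cbar_mul_para, smul_smul, inv_mul_cancel₀ hx.ne', one_smul]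
    have hinvY : inv (M.c * para y) = (ρ⁻¹ • para (cbar y)) * inv M.c := by
      refine inv_eq_of_mul_eq_one ?_ ?_
      · rw [mul_assoc, ← mul_assoc (para y), hI1, one_mul, hci]
      · rw [mul_assoc, ← mul_assoc (inv M.c), hic, one_mul, hI2]
    have haxb : axb M.toSAV x = M.a * para y - r⁻¹ • involute M.c := by
      rw [axb, mul_def, ← hb, hy, para_add, mul_add]
      abel
    rw [moebius, moebiusCl, hcxd, ← hy, hinvY, haxb, mul_def, sub_mul, mul_assoc M.a,
      ← mul_assoc (para y), hI1, one_mul, sub_eq_add_neg, paraCoord_add]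
    congr 1
    have hJ : (fun j => y j * ρ ^ (-1 : ℝ)) = ρ⁻¹ • y := by
      funext j
      rw [Real.rpow_neg_one, Pi.smul_apply, smul_eq_mul, mul_comm]
    rw [hJ, LinearMap.neg_apply, LinearMap.comp_apply, map_smul, map_smul, ← smul_neg,
      ← paraCoord_para (ρ⁻¹ • -B (cbar y)), para_smul, ← neg_one_smul ℝ (B _), para_smul, hB,
      hinv]
    simp only [smul_mul_assoc, mul_smul_comm, smul_smul, mul_assoc, ← neg_smul]
    congr 2
    ring
  · rw [hcxd, norm_of_mul_conj_self (hcY _)]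

lemma IsHypHarmonic.moebius {k : ℝ} {u : (Fin (m + 2) → ℝ) → ℝ} (hu : IsHypHarmonic k u)
    (M : SAVsub m) :
    IsHypHarmonic k (fun x => norm (cxd M.toSAV x) ^ (-(((m + 1 : ℕ) : ℝ) - k - 1)) *
      u (moebius M.toSAV x)) := by
  by_cases hc : M.c = 0
  · obtain ⟨r, B, s, hr, hB, hBl, hs, hM, hN⟩ := M.moebius_of_c_eq_zero hc
    refine (hu.comp_similarity B hr hB hBl s hs
      (Cl.norm M.d ^ (-(((m + 1 : ℕ) : ℝ) - k - 1)))).congr fun x _ => ?_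
    rw [hN, hM]
  · obtain ⟨r, B, s, t, hr, hB, hBl, hs, ht, hM, hN⟩ := M.moebius_of_c_ne_zero hc
    have h1 := (hu.comp_similarity B (inv_pos.mpr hr) hB hBl s hs 1).kelvin
    refine (h1.comp_similarity LinearMap.id one_pos (by simp) (by simp) t ht
      (r ^ (-(((m + 1 : ℕ) : ℝ) - k - 1) / 2))).congr fun x hx => ?_
    have hy : 0 < ∑ i, (t + x) i ^ 2 := sum_sq_pos_of_mem (by
      change 0 < (t + x) (Fin.last (m + 1))
      rw [Pi.add_apply, ht, zero_add]
      exact hx)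
    rw [hN, hM x hy, Real.sqrt_eq_rpow, ← Real.rpow_mul (by positivity),
      Real.mul_rpow hr.le hy.le, one_div_mul_eq_div]
    simp only [LinearMap.id_apply, one_mul]
    ring

end Moebius

end Cl

/-- Quasi-invariance of the `k`-hyperbolic harmonic equation under Möbius transformations
induced by `M ∈ SAV(ℝ ⊕ ℝ^{n-1})` (`n = m + 2 ≥ 2`): if `xₙ Δu - k ∂u/∂xₙ = 0`, then
`F = ‖cx+d‖^{-(n-k-1)} u(M<x>)` also satisfies `xₙ ΔF - k ∂F/∂xₙ = 0` on `H⁺`. -/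
theorem k_hyperbolic_harmonic_moebius_invariance
    (m : ℕ) (k : ℝ) (M : Cl.SAVsub (m + 1))
    (u : (Fin (m + 3) → ℝ) → ℝ)
    (hu : ContDiffOn ℝ (⊤ : ℕ∞) u (Cl.upperHalf (m + 2)))
    (heq : ∀ x ∈ Cl.upperHalf (m + 2),
      x (Fin.last (m + 2)) * Cl.lap u x - k * Cl.pderiv (Fin.last (m + 2)) u x = 0)
    (F : (Fin (m + 3) → ℝ) → ℝ)
    (hF : F = fun x => Cl.norm (Cl.cxd M.toSAV x) ^ (-(((m : ℝ) + 2) - k - 1)) *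
      u (Cl.moebius M.toSAV x)) :
    ∀ x ∈ Cl.upperHalf (m + 2),
      x (Fin.last (m + 2)) * Cl.lap F x - k * Cl.pderiv (Fin.last (m + 2)) F x = 0 := by
  have h := Cl.IsHypHarmonic.moebius (⟨hu, heq⟩ : Cl.IsHypHarmonic k u) M
  have he : ((m + 1 + 1 : ℕ) : ℝ) = (m : ℝ) + 2 := by
    push_cast
    ring
  rw [he, ← hF] at h
  exact h.2
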